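/- arXiv:1911.10449 — 2 statements merged into one kernel-verified Lean document; each statement's English description precedes it below -/
import Mathlib

section
/- For all ε, δ > 0, σ(δ) ≤ (δ/ε)·log₂(|𝒳₁||𝒳₂|) + σ₁(ε), where σ(δ) = lim_n σ_n(δ) = sup_n σ_n(δ) and σ₁ is the single-letter function. -/
open scoped BigOperators Classical

/-- Probability that the random variable `A` takes the value `a`, under the pmf `p`
on a finite sample space `Ω`. -/
noncomputable def prOf {Ω α : Type*} [Fintype Ω] (p : Ω → ℝ) (A : Ω → α) (a : α) : ℝ :=
  ∑ ω, if A ω = a then p ω else 0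

/-- `p` is a probability mass function on the finite type `Ω`. -/
def IsPmf {Ω : Type*} [Fintype Ω] (p : Ω → ℝ) : Prop :=
  (∀ ω, 0 ≤ p ω) ∧ ∑ ω, p ω = 1

/-- Mutual information `I(A;B)` (base-2 logarithm) of random variables `A, B`
on a finite probability space `(Ω, p)`. -/
noncomputable def mutualInfo {Ω α β : Type*} [Fintype Ω] [Fintype α] [Fintype β]
    (p : Ω → ℝ) (A : Ω → α) (B : Ω → β) : ℝ :=
  ∑ a, ∑ b, prOf p (fun ω => (A ω, B ω)) (a, b) *
    Real.logb 2 (prOf p (fun ω => (A ω, B ω)) (a, b) / (prOf p A a * prOf p B b))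

/-- Conditional mutual information `I(A;B|C)` (base-2 logarithm). -/
noncomputable def condMutualInfo {Ω α β γ : Type*} [Fintype Ω] [Fintype α] [Fintype β]
    [Fintype γ] (p : Ω → ℝ) (A : Ω → α) (B : Ω → β) (C : Ω → γ) : ℝ :=
  ∑ a, ∑ b, ∑ c, prOf p (fun ω => (A ω, B ω, C ω)) (a, b, c) *
    Real.logb 2 (prOf p (fun ω => (A ω, B ω, C ω)) (a, b, c) * prOf p C c /
      (prOf p (fun ω => (A ω, C ω)) (a, c) * prOf p (fun ω => (B ω, C ω)) (b, c)))

variable {𝒳₁ 𝒳₂ 𝒴 : Type} [Fintype 𝒳₁] [Fintype 𝒳₂] [Fintype 𝒴]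

/-- Joint distribution of `(U, X₁ⁿ, X₂ⁿ, Yⁿ)` obtained by sending the inputs through
`n` memoryless uses of the channel `W`. -/
noncomputable def jointWithOutput (W : 𝒳₁ × 𝒳₂ → 𝒴 → ℝ) (n : ℕ) {𝒰 : Type}
    (p : 𝒰 × (Fin n → 𝒳₁) × (Fin n → 𝒳₂) → ℝ) :
    𝒰 × (Fin n → 𝒳₁) × (Fin n → 𝒳₂) × (Fin n → 𝒴) → ℝ :=
  fun z => p (z.1, z.2.1, z.2.2.1) * ∏ t, W (z.2.1 t, z.2.2.1 t) (z.2.2.2 t)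

/-- The `n`-letter function `σ_n(δ)`: the supremum over all finite auxiliary alphabets
`𝒰` (wlog `Fin k`) and joint distributions `p(u, x₁ⁿ, x₂ⁿ)` with `I(X₁ⁿ;X₂ⁿ|U) ≤ nδ`
of `(1/n)·I(X₁ⁿ,X₂ⁿ;Yⁿ|U)`. -/
noncomputable def sigman (W : 𝒳₁ × 𝒳₂ → 𝒴 → ℝ) (n : ℕ) (δ : ℝ) : ℝ :=
  sSup {r : ℝ | ∃ (k : ℕ) (p : Fin k × (Fin n → 𝒳₁) × (Fin n → 𝒳₂) → ℝ),
    IsPmf p ∧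
    condMutualInfo p (fun z => z.2.1) (fun z => z.2.2) (fun z => z.1) ≤ n * δ ∧
    r = (1 / n) * condMutualInfo (jointWithOutput W n p)
      (fun z => (z.2.1, z.2.2.1)) (fun z => z.2.2.2) (fun z => z.1)}

section Entropy

variable {Ω α β γ : Type*} [Fintype Ω]

/-- Entropy (base 2) of the random variable `A`, as an expectation over the sample space. -/
noncomputable def ent (p : Ω → ℝ) (A : Ω → α) : ℝ :=
  -∑ ω, p ω * Real.logb 2 (prOf p A (A ω))

theorem prOf_nonneg {p : Ω → ℝ} (hp : ∀ ω, 0 ≤ p ω) (A : Ω → α) (a : α) : 0 ≤ prOf p A a :=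
  Finset.sum_nonneg fun ω _ => by split_ifs <;> simp [hp ω]

theorem prOf_mono {p : Ω → ℝ} (hp : ∀ ω, 0 ≤ p ω) {A : Ω → α} {B : Ω → β} {a : α} {b : β}
    (h : ∀ ω, A ω = a → B ω = b) : prOf p A a ≤ prOf p B b := by
  refine Finset.sum_le_sum fun ω _ => ?_
  by_cases hA : A ω = a
  · simp [hA, h ω hA]
  · rw [if_neg hA]
    split_ifs <;> simp [hp ω]

theorem prOf_congr (p : Ω → ℝ) {A : Ω → α} {B : Ω → β} {a : α} {b : β}
    (h : ∀ ω, A ω = a ↔ B ω = b) : prOf p A a = prOf p B b := by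
  simp only [prOf, h]

theorem prOf_self_pos {p : Ω → ℝ} (hp : ∀ ω, 0 ≤ p ω) (A : Ω → α) {ω : Ω} (hω : 0 < p ω) :
    0 < prOf p A (A ω) := by
  refine lt_of_lt_of_le hω ?_
  have := Finset.single_le_sum (f := fun ω' => if A ω' = A ω then p ω' else 0) (s := Finset.univ)
    (fun ω' _ => by split_ifs <;> simp [hp ω']) (Finset.mem_univ ω)
  simpa [prOf] using this

theorem sum_prOf_mul [Fintype α] (p : Ω → ℝ) (A : Ω → α) (f : α → ℝ) :
    ∑ a, prOf p A a * f a = ∑ ω, p ω * f (A ω) := by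
  simp only [prOf, Finset.sum_mul]
  rw [Finset.sum_comm]
  refine Finset.sum_congr rfl fun ω _ => ?_
  simp [ite_mul]

theorem sum_prOf_pair_left [Fintype α] (p : Ω → ℝ) (A : Ω → α) (C : Ω → γ) (c : γ) :
    ∑ a, prOf p (fun ω => (A ω, C ω)) (a, c) = prOf p C c := by
  simp only [prOf]
  rw [Finset.sum_comm]
  refine Finset.sum_congr rfl fun ω _ => ?_
  by_cases h : C ω = c <;> simp [h]

theorem prOf_prOf [Fintype α] (p : Ω → ℝ) (φ : Ω → α) (A : α → β) (b : β) :
    prOf (prOf p φ) A b = prOf p (fun ω => A (φ ω)) b := by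
  have := sum_prOf_mul p φ (fun a => if A a = b then 1 else 0)
  simpa [prOf] using this

theorem isPmf_prOf [Fintype α] {p : Ω → ℝ} (hp : IsPmf p) (φ : Ω → α) : IsPmf (prOf p φ) := by
  refine ⟨prOf_nonneg hp.1 φ, ?_⟩
  have := sum_prOf_mul p φ (fun _ => 1)
  simpa [hp.2] using this

theorem condMutualInfo_prOf {Ω' : Type*} [Fintype Ω'] [Fintype α] [Fintype β] [Fintype γ]
    (p : Ω' → ℝ) (φ : Ω' → Ω) (A : Ω → α) (B : Ω → β) (C : Ω → γ) :
    condMutualInfo (prOf p φ) A B C =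
      condMutualInfo p (fun ω => A (φ ω)) (fun ω => B (φ ω)) (fun ω => C (φ ω)) := by
  simp only [condMutualInfo, prOf_prOf]

theorem condMutualInfo_eq_ent [Fintype α] [Fintype β] [Fintype γ] {p : Ω → ℝ}
    (hp : ∀ ω, 0 ≤ p ω) (A : Ω → α) (B : Ω → β) (C : Ω → γ) :
    condMutualInfo p A B C = ent p (fun ω => (A ω, C ω)) + ent p (fun ω => (B ω, C ω)) -
      ent p (fun ω => (A ω, B ω, C ω)) - ent p C := by
  have key := sum_prOf_mul p (fun ω => (A ω, B ω, C ω)) (fun x =>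
    Real.logb 2 (prOf p (fun ω => (A ω, B ω, C ω)) x * prOf p C x.2.2 /
      (prOf p (fun ω => (A ω, C ω)) (x.1, x.2.2) * prOf p (fun ω => (B ω, C ω)) (x.2.1, x.2.2))))
  simp only [Fintype.sum_prod_type] at key
  rw [condMutualInfo, key]
  simp only [ent]
  rw [← sub_eq_zero]
  simp only [← Finset.sum_neg_distrib, ← Finset.sum_add_distrib, ← Finset.sum_sub_distrib]
  refine Finset.sum_eq_zero fun ω _ => ?_
  rcases (hp ω).eq_or_lt with h | h
  · simp [← h]
  · have h1 := (prOf_self_pos hp (fun ω => (A ω, B ω, C ω)) h).ne'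
    have h2 := (prOf_self_pos hp (fun ω => (A ω, C ω)) h).ne'
    have h3 := (prOf_self_pos hp (fun ω => (B ω, C ω)) h).ne'
    have h4 := (prOf_self_pos hp C h).ne'
    rw [Real.logb_div (mul_ne_zero h1 h4) (mul_ne_zero h2 h3), Real.logb_mul h1 h4,
      Real.logb_mul h2 h3]
    ring

theorem ent_le_ent {p : Ω → ℝ} (hp : ∀ ω, 0 ≤ p ω) {A : Ω → α} {B : Ω → β}
    (h : ∀ ω ω', B ω = B ω' → A ω = A ω') : ent p A ≤ ent p B := by
  refine neg_le_neg (Finset.sum_le_sum fun ω _ => ?_)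
  rcases (hp ω).eq_or_lt with h0 | h0
  · simp [← h0]
  · refine mul_le_mul_of_nonneg_left ?_ h0.le
    exact Real.logb_le_logb_of_le one_lt_two (prOf_self_pos hp B h0)
      (prOf_mono hp fun ω' => h ω' ω)

theorem ent_congr {p : Ω → ℝ} (hp : ∀ ω, 0 ≤ p ω) {A : Ω → α} {B : Ω → β}
    (h : ∀ ω η, A ω = A η ↔ B ω = B η) : ent p A = ent p B :=
  le_antisymm (ent_le_ent hp fun ω η => (h ω η).2) (ent_le_ent hp fun ω η => (h ω η).1)

/-- The Gibbs inequality, for a likelihood ratio `r`. -/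
theorem sum_mul_logb_nonpos {p r : Ω → ℝ} (hp : IsPmf p) (hr : ∀ ω, 0 < p ω → 0 < r ω)
    (hsum : ∑ ω, p ω * r ω ≤ 1) : ∑ ω, p ω * Real.logb 2 (r ω) ≤ 0 := by
  have hlog : (0 : ℝ) < Real.log 2 := Real.log_pos one_lt_two
  have h1 : ∑ ω, p ω * Real.log (r ω) ≤ ∑ ω, p ω * (r ω - 1) := by
    refine Finset.sum_le_sum fun ω _ => ?_
    rcases (hp.1 ω).eq_or_lt with h0 | h0
    · simp [← h0]
    · exact mul_le_mul_of_nonneg_left (Real.log_le_sub_one_of_pos (hr ω h0)) h0.le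
  have h2 : ∑ ω, p ω * (r ω - 1) ≤ 0 := by
    simp only [mul_sub, mul_one, Finset.sum_sub_distrib, hp.2]
    linarith
  have h3 : ∑ ω, p ω * Real.logb 2 (r ω) = (∑ ω, p ω * Real.log (r ω)) / Real.log 2 := by
    simp only [Real.logb, Finset.sum_div, mul_div_assoc]
  rw [h3]
  exact div_nonpos_of_nonpos_of_nonneg (h1.trans h2) hlog.le

/-- Submodularity of entropy. -/
theorem ent_submodular [Fintype α] [Fintype β] [Fintype γ] {p : Ω → ℝ} (hp : IsPmf p)
    (A : Ω → α) (B : Ω → β) (C : Ω → γ) :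
    ent p (fun ω => (A ω, B ω, C ω)) + ent p C ≤
      ent p (fun ω => (A ω, C ω)) + ent p (fun ω => (B ω, C ω)) := by
  set P := prOf p (fun ω => (A ω, B ω, C ω)) with hP
  set Q := prOf p (fun ω => (A ω, C ω)) with hQ
  set R := prOf p (fun ω => (B ω, C ω)) with hR
  set S := prOf p C with hS
  have hQ0 : ∀ x, 0 ≤ Q x := prOf_nonneg hp.1 _
  have hR0 : ∀ x, 0 ≤ R x := prOf_nonneg hp.1 _
  have hS0 : ∀ x, 0 ≤ S x := prOf_nonneg hp.1 _
  have hsum : ∑ ω, p ω * (Q (A ω, C ω) * R (B ω, C ω) /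
      (P (A ω, B ω, C ω) * S (C ω))) ≤ 1 := by
    have key := sum_prOf_mul p (fun ω => (A ω, B ω, C ω))
      (fun x => Q (x.1, x.2.2) * R (x.2.1, x.2.2) / (P x * S x.2.2))
    rw [← key]
    calc ∑ x, P x * (Q (x.1, x.2.2) * R (x.2.1, x.2.2) / (P x * S x.2.2))
        ≤ ∑ x : α × β × γ, Q (x.1, x.2.2) * R (x.2.1, x.2.2) / S x.2.2 := by
          refine Finset.sum_le_sum fun x _ => ?_
          by_cases h : P x = 0
          · rw [h, zero_mul]
            exact div_nonneg (mul_nonneg (hQ0 _) (hR0 _)) (hS0 _)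
          · rw [← mul_div_assoc, mul_div_mul_left _ _ h]
      _ = ∑ c, S c := by
          simp only [Fintype.sum_prod_type]
          rw [Finset.sum_congr rfl fun a _ => Finset.sum_comm, Finset.sum_comm]
          refine Finset.sum_congr rfl fun c _ => ?_
          simp only [← Finset.sum_div, ← Finset.mul_sum, ← Finset.sum_mul]
          rw [hQ, hR, sum_prOf_pair_left, sum_prOf_pair_left, mul_self_div_self]
      _ = 1 := (isPmf_prOf hp C).2
  have hlog := sum_mul_logb_nonpos hp (r := fun ω => Q (A ω, C ω) * R (B ω, C ω) /
      (P (A ω, B ω, C ω) * S (C ω))) (fun ω h =>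
      div_pos (mul_pos (prOf_self_pos hp.1 (fun ω => (A ω, C ω)) h)
        (prOf_self_pos hp.1 (fun ω => (B ω, C ω)) h))
        (mul_pos (prOf_self_pos hp.1 (fun ω => (A ω, B ω, C ω)) h) (prOf_self_pos hp.1 C h))) hsum
  have hident := condMutualInfo_eq_ent hp.1 A B C
  suffices h : ∑ ω, p ω * Real.logb 2 (Q (A ω, C ω) * R (B ω, C ω) /
      (P (A ω, B ω, C ω) * S (C ω))) = -condMutualInfo p A B C by linarith
  have key := sum_prOf_mul p (fun ω => (A ω, B ω, C ω)) (fun x =>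
    Real.logb 2 (P x * S x.2.2 / (Q (x.1, x.2.2) * R (x.2.1, x.2.2))))
  simp only [Fintype.sum_prod_type] at key
  rw [condMutualInfo, key, ← Finset.sum_neg_distrib]
  refine Finset.sum_congr rfl fun ω _ => ?_
  rw [← inv_div, Real.logb_inv]
  ring

theorem ent_pair_le_card [Fintype α] [Fintype γ] {p : Ω → ℝ} (hp : IsPmf p)
    (A : Ω → α) (C : Ω → γ) :
    ent p (fun ω => (A ω, C ω)) ≤ ent p C + Real.logb 2 (Fintype.card α) := by
  have hne : Nonempty α := by
    by_contra h
    rw [not_nonempty_iff] at h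
    have : IsEmpty Ω := ⟨fun ω => h.elim (A ω)⟩
    simpa using hp.2
  have hcard : (0 : ℝ) < Fintype.card α := by exact_mod_cast Fintype.card_pos
  set Q := prOf p (fun ω => (A ω, C ω)) with hQ
  set S := prOf p C with hS
  have hS0 : ∀ x, 0 ≤ S x := prOf_nonneg hp.1 _
  have hsum : ∑ ω, p ω * (S (C ω) / (Q (A ω, C ω) * Fintype.card α)) ≤ 1 := by
    have key := sum_prOf_mul p (fun ω => (A ω, C ω))
      (fun x => S x.2 / (Q x * Fintype.card α))
    rw [← key]
    calc ∑ x, Q x * (S x.2 / (Q x * Fintype.card α))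
        ≤ ∑ x : α × γ, S x.2 / Fintype.card α := by
          refine Finset.sum_le_sum fun x _ => ?_
          by_cases h : Q x = 0
          · rw [h, zero_mul]
            exact div_nonneg (hS0 _) hcard.le
          · rw [← mul_div_assoc, mul_div_mul_left _ _ h]
      _ = ∑ c, S c := by
          simp only [Fintype.sum_prod_type, Finset.sum_const, Finset.card_univ, nsmul_eq_mul,
            ← Finset.sum_div]
          field_simp
      _ = 1 := (isPmf_prOf hp C).2
  have hlog := sum_mul_logb_nonpos hp (r := fun ω => S (C ω) / (Q (A ω, C ω) * Fintype.card α))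
    (fun ω h => div_pos (prOf_self_pos hp.1 C h)
      (mul_pos (prOf_self_pos hp.1 (fun ω => (A ω, C ω)) h) hcard)) hsum
  suffices h : ∑ ω, p ω * Real.logb 2 (S (C ω) / (Q (A ω, C ω) * Fintype.card α)) =
      ent p (fun ω => (A ω, C ω)) - ent p C -
        (∑ ω, p ω) * Real.logb 2 (Fintype.card α) by
    rw [hp.2] at h
    linarith
  simp only [ent, Finset.sum_mul, ← Finset.sum_neg_distrib, ← Finset.sum_sub_distrib]
  refine Finset.sum_congr rfl fun ω _ => ?_
  rcases (hp.1 ω).eq_or_lt with h | h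
  · simp [← h]
  · have h2 : Q (A ω, C ω) ≠ 0 := (prOf_self_pos hp.1 (fun ω => (A ω, C ω)) h).ne'
    have h4 : S (C ω) ≠ 0 := (prOf_self_pos hp.1 C h).ne'
    rw [Real.logb_div h4 (mul_ne_zero h2 hcard.ne'), Real.logb_mul h2 hcard.ne']
    ring

theorem condMutualInfo_nonneg [Fintype α] [Fintype β] [Fintype γ] {p : Ω → ℝ} (hp : IsPmf p)
    (A : Ω → α) (B : Ω → β) (C : Ω → γ) : 0 ≤ condMutualInfo p A B C := by
  rw [condMutualInfo_eq_ent hp.1]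
  linarith [ent_submodular hp A B C]

theorem condMutualInfo_le_card [Fintype α] [Fintype β] [Fintype γ] {p : Ω → ℝ} (hp : IsPmf p)
    (A : Ω → α) (B : Ω → β) (C : Ω → γ) :
    condMutualInfo p A B C ≤ Real.logb 2 (Fintype.card α) := by
  rw [condMutualInfo_eq_ent hp.1]
  have h1 := ent_pair_le_card hp A C
  have h2 : ent p (fun ω => (B ω, C ω)) ≤ ent p (fun ω => (A ω, B ω, C ω)) :=
    ent_le_ent hp.1 (by simp +contextual)
  linarith

theorem condMutualInfo_congr {α' β' γ' : Type*} [Fintype α] [Fintype β] [Fintype γ]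
    [Fintype α'] [Fintype β'] [Fintype γ'] {p : Ω → ℝ} (hp : ∀ ω, 0 ≤ p ω)
    {A : Ω → α} {B : Ω → β} {C : Ω → γ} {A' : Ω → α'} {B' : Ω → β'} {C' : Ω → γ'}
    (hA : ∀ ω ω', A ω = A ω' ↔ A' ω = A' ω') (hB : ∀ ω ω', B ω = B ω' ↔ B' ω = B' ω')
    (hC : ∀ ω ω', C ω = C ω' ↔ C' ω = C' ω') :
    condMutualInfo p A B C = condMutualInfo p A' B' C' := by
  rw [condMutualInfo_eq_ent hp, condMutualInfo_eq_ent hp, ent_congr hp hC,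
    ent_congr hp (A := fun ω => (A ω, C ω)) (B := fun ω => (A' ω, C' ω)) (by simp [hA, hC]),
    ent_congr hp (A := fun ω => (B ω, C ω)) (B := fun ω => (B' ω, C' ω)) (by simp [hB, hC]),
    ent_congr hp (A := fun ω => (A ω, B ω, C ω)) (B := fun ω => (A' ω, B' ω, C' ω))
      (by simp [hA, hB, hC])]

end Entropy

section Wringing

variable {Ω α β ν : Type*} [Fintype Ω] {n : ℕ}

/-- The restriction of the word `x` to the coordinates in `T`, with the others erased. -/
noncomputable def mask (T : Finset (Fin n)) (x : Fin n → α) : Fin n → Option α :=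
  fun i => if i ∈ T then some (x i) else none

theorem mask_eq_iff (T : Finset (Fin n)) (x y : Fin n → α) :
    mask T x = mask T y ↔ ∀ i ∈ T, x i = y i := by
  simp only [mask, funext_iff]
  refine forall_congr' fun i => ?_
  by_cases h : i ∈ T <;> simp [h]

theorem ent_mask_le [Fintype α] [Fintype ν] {p : Ω → ℝ} (hp : IsPmf p) (Z : Ω → Fin n → α)
    (V : Ω → ν) (T : Finset (Fin n)) :
    ent p (fun ω => (mask T (Z ω), V ω)) ≤
      ent p V + ∑ t ∈ T, (ent p (fun ω => (Z ω t, V ω)) - ent p V) := by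
  induction T using Finset.induction_on with
  | empty =>
    rw [ent_congr hp.1 (B := V) (by simp [mask_eq_iff])]
    simp
  | insert t T ht ih =>
    rw [Finset.sum_insert ht,
      ent_congr hp.1 (B := fun ω => (mask T (Z ω), Z ω t, V ω))
        (by simp [mask_eq_iff]; tauto)]
    linarith [ent_submodular hp (fun ω => mask T (Z ω)) (fun ω => Z ω t) V]

/-- Conditioning on one more pair of coordinates lowers the mutual information between the two
words by at least the mutual information of that pair. -/
theorem condMutualInfo_add_le [Fintype α] [Fintype β] [Fintype ν] {p : Ω → ℝ} (hp : IsPmf p)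
    (A : Ω → Fin n → α) (B : Ω → Fin n → β) (C : Ω → ν) (t : Fin n) :
    condMutualInfo p (fun ω => A ω t) (fun ω => B ω t) C +
      condMutualInfo p A B (fun ω => (A ω t, B ω t, C ω)) ≤ condMutualInfo p A B C := by
  simp only [condMutualInfo_eq_ent hp.1]
  have h1 := ent_submodular hp A (fun ω => B ω t) (fun ω => (A ω t, C ω))
  have h2 := ent_submodular hp B (fun ω => A ω t) (fun ω => (B ω t, C ω))
  rw [ent_congr hp.1 (A := fun ω => (A ω, B ω t, A ω t, C ω))
      (B := fun ω => (A ω, A ω t, B ω t, C ω)) (by simp; tauto),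
    ent_congr hp.1 (A := fun ω => (A ω, A ω t, C ω)) (B := fun ω => (A ω, C ω))
      (by simp +contextual),
    ent_congr hp.1 (A := fun ω => (B ω t, A ω t, C ω)) (B := fun ω => (A ω t, B ω t, C ω))
      (by simp; tauto)] at h1
  rw [ent_congr hp.1 (A := fun ω => (B ω, B ω t, C ω)) (B := fun ω => (B ω, C ω))
      (by simp +contextual)] at h2
  rw [ent_congr hp.1 (A := fun ω => (A ω, B ω, A ω t, B ω t, C ω))
      (B := fun ω => (A ω, B ω, C ω)) (by simp +contextual)]
  linarith

theorem condMutualInfo_eq_zero [Fintype α] [Fintype β] [Fintype ν] {p : Ω → ℝ}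
    (hp : ∀ ω, 0 ≤ p ω) {A : Ω → α} {B : Ω → β} {C : Ω → ν}
    (h : ∀ ω ω', C ω = C ω' → A ω = A ω') : condMutualInfo p A B C = 0 := by
  rw [condMutualInfo_eq_ent hp,
    ent_congr hp (A := fun ω => (A ω, C ω)) (B := C) (by simpa using h),
    ent_congr hp (A := fun ω => (A ω, B ω, C ω)) (B := fun ω => (B ω, C ω))
      (by simp; exact fun ω η _ => h ω η)]
  ring

/-- Dueck's wringing lemma. -/
theorem exists_wringing_set [Fintype α] [Fintype β] [Fintype ν] {p : Ω → ℝ} (hp : IsPmf p)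
    (A : Ω → Fin n → α) (B : Ω → Fin n → β) (U : Ω → ν) {ε K : ℝ} (hε : 0 < ε)
    (hK : condMutualInfo p A B U ≤ K) :
    ∃ T : Finset (Fin n), T.card * ε ≤ K ∧ ∀ t,
      condMutualInfo p (fun ω => A ω t) (fun ω => B ω t)
        (fun ω => (U ω, mask T (A ω), mask T (B ω))) ≤ ε := by
  let good : Finset (Finset (Fin n)) := Finset.univ.filter fun T =>
    condMutualInfo p A B (fun ω => (U ω, mask T (A ω), mask T (B ω))) + T.card * ε ≤ K
  have hgood : good.Nonempty := by
    refine ⟨∅, ?_⟩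
    rw [Finset.mem_filter]
    refine ⟨Finset.mem_univ _, ?_⟩
    rw [condMutualInfo_congr hp.1 (A' := A) (B' := B) (C' := U) (by simp) (by simp)
      (by simp [mask_eq_iff])]
    simpa using hK
  obtain ⟨T, hT, hmax⟩ := Finset.exists_max_image good Finset.card hgood
  have hTK := (Finset.mem_filter.1 hT).2
  refine ⟨T, ?_, fun t => ?_⟩
  · linarith [condMutualInfo_nonneg hp A B (fun ω => (U ω, mask T (A ω), mask T (B ω)))]
  by_contra! hlt
  have ht : t ∉ T := by
    intro ht
    rw [condMutualInfo_eq_zero hp.1] at hlt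
    · exact absurd hlt hε.not_gt
    · intro ω ω' h
      simp only [Prod.mk.injEq, mask_eq_iff] at h
      exact h.2.1 t ht
  have hins : insert t T ∈ good := by
    rw [Finset.mem_filter]
    refine ⟨Finset.mem_univ _, ?_⟩
    have hstep := condMutualInfo_add_le hp A B
      (fun ω => (U ω, mask T (A ω), mask T (B ω))) t
    rw [condMutualInfo_congr hp.1 (A' := A) (B' := B)
      (C' := fun ω => (A ω t, B ω t, U ω, mask T (A ω), mask T (B ω))) (by simp) (by simp)
      (by simp [mask_eq_iff]; tauto), Finset.card_insert_of_notMem ht]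
    push_cast
    linarith
  have := hmax _ hins
  rw [Finset.card_insert_of_notMem ht] at this
  omega

end Wringing

section Channel

theorem sum_prod_of_apply_eq {n : ℕ} (w : Fin n → 𝒴 → ℝ) (hw : ∀ s, ∑ y, w s y = 1)
    (t : Fin n) (y : 𝒴) :
    ∑ y' : Fin n → 𝒴, (if y' t = y then ∏ s, w s (y' s) else 0) = w t y := by
  have h := Fintype.prod_sum
    (fun s y' => if s = t then (if y' = y then w s y' else 0) else w s y')
  have hL : ∏ s, ∑ y', (if s = t then (if y' = y then w s y' else 0) else w s y') = w t y := by
    rw [Finset.prod_eq_single t]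
    · simp
    · intro s _ hs
      simp [hs, hw]
    · simp
  rw [← hL, h]
  refine Finset.sum_congr rfl fun y' _ => ?_
  split_ifs with hy
  · refine Finset.prod_congr rfl fun s _ => ?_
    by_cases hs : s = t
    · subst hs
      simp [hy]
    · simp [hs]
  · refine (Finset.prod_eq_zero (Finset.mem_univ t) ?_).symm
    simp [hy]

theorem sum_prod_eq_one {n : ℕ} (w : Fin n → 𝒴 → ℝ) (hw : ∀ s, ∑ y, w s y = 1) :
    ∑ y' : Fin n → 𝒴, ∏ s, w s (y' s) = 1 := by
  rw [← Fintype.prod_sum]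
  simp [hw]

variable {W : 𝒳₁ × 𝒳₂ → 𝒴 → ℝ} {n : ℕ} {𝒰 : Type} [Fintype 𝒰]
  {p : 𝒰 × (Fin n → 𝒳₁) × (Fin n → 𝒳₂) → ℝ}

theorem sum_jointWithOutput_mul (G : 𝒰 × (Fin n → 𝒳₁) × (Fin n → 𝒳₂) → (Fin n → 𝒴) → ℝ) :
    ∑ z, jointWithOutput W n p z * G (z.1, z.2.1, z.2.2.1) z.2.2.2 =
      ∑ b, p b * ∑ y, (∏ s, W (b.2.1 s, b.2.2 s) (y s)) * G b y := by
  simp only [jointWithOutput, Fintype.sum_prod_type, Finset.mul_sum, mul_assoc]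

theorem prOf_jointWithOutput (hW : ∀ x, IsPmf (W x)) :
    prOf (jointWithOutput W n p) (fun z => (z.1, z.2.1, z.2.2.1)) = p := by
  funext b₀
  have h := sum_jointWithOutput_mul (W := W) (p := p) (fun b _ => if b = b₀ then 1 else 0)
  simp only [← Finset.sum_mul, sum_prod_eq_one _ fun s => (hW _).2] at h
  simp only [mul_ite, mul_one, mul_zero, Finset.sum_ite_eq', Finset.mem_univ,
    if_true] at h
  rw [← h]
  exact Finset.sum_congr rfl fun z _ => by congr

theorem isPmf_jointWithOutput (hW : ∀ x, IsPmf (W x)) (hp : IsPmf p) :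
    IsPmf (jointWithOutput W n p) := by
  refine ⟨fun z => mul_nonneg (hp.1 _) (Finset.prod_nonneg fun t _ => (hW _).1 _), ?_⟩
  have h := (sum_prOf_mul (jointWithOutput W n p) (fun z => (z.1, z.2.1, z.2.2.1)) fun _ => 1)
  rw [prOf_jointWithOutput hW] at h
  simpa [hp.2] using h.symm

/-- Memorylessness: given the inputs, the `t`-th output is distributed according to `W`. -/
theorem prOf_output {μ : Type*} (hW : ∀ x, IsPmf (W x)) (t : Fin n)
    (g : 𝒰 × (Fin n → 𝒳₁) × (Fin n → 𝒳₂) → μ) (m : μ) (y : 𝒴) (c : ℝ)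
    (hc : ∀ b, g b = m → W (b.2.1 t, b.2.2 t) y = c) :
    prOf (jointWithOutput W n p) (fun z => (g (z.1, z.2.1, z.2.2.1), z.2.2.2 t)) (m, y) =
      prOf p g m * c := by
  have h := sum_jointWithOutput_mul (W := W) (p := p)
    (fun b y' => if (g b, y' t) = (m, y) then 1 else 0)
  simp only [mul_ite, mul_one, mul_zero] at h
  simp only [prOf]
  rw [Finset.sum_mul]
  refine (Finset.sum_congr rfl fun z _ => by congr).trans (h.trans ?_)
  refine Finset.sum_congr rfl fun b _ => ?_
  by_cases hb : g b = m
  · simp only [hb, Prod.mk.injEq, true_and, if_true]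
    rw [sum_prod_of_apply_eq _ (fun s => (hW _).2) t y, hc b hb]
  · simp [hb]

theorem prOf_input {μ : Type*} (hW : ∀ x, IsPmf (W x))
    (g : 𝒰 × (Fin n → 𝒳₁) × (Fin n → 𝒳₂) → μ) (m : μ) :
    prOf (jointWithOutput W n p) (fun z => g (z.1, z.2.1, z.2.2.1)) m = prOf p g m := by
  rw [← prOf_prOf (jointWithOutput W n p) (fun z => (z.1, z.2.1, z.2.2.1)) g,
    prOf_jointWithOutput hW]

theorem ent_output {μ : Type*} (hW : ∀ x, IsPmf (W x)) (hp : IsPmf p) (t : Fin n)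
    (g : 𝒰 × (Fin n → 𝒳₁) × (Fin n → 𝒳₂) → μ)
    (hg : ∀ b b', g b = g b' → b.2.1 t = b'.2.1 t ∧ b.2.2 t = b'.2.2 t) :
    ent (jointWithOutput W n p) (fun z => (g (z.1, z.2.1, z.2.2.1), z.2.2.2 t)) =
      ent (jointWithOutput W n p) (fun z => g (z.1, z.2.1, z.2.2.1)) -
        ∑ z, jointWithOutput W n p z * Real.logb 2 (W (z.2.1 t, z.2.2.1 t) (z.2.2.2 t)) := by
  have hq := isPmf_jointWithOutput hW hp
  simp only [ent, ← Finset.sum_neg_distrib, ← Finset.sum_sub_distrib]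
  refine Finset.sum_congr rfl fun z _ => ?_
  rcases (hq.1 z).eq_or_lt with h | h
  · simp [← h]
  · have h1 := prOf_self_pos hq.1 (fun z => (g (z.1, z.2.1, z.2.2.1), z.2.2.2 t)) h
    have h2 := prOf_self_pos hq.1 (fun z => g (z.1, z.2.1, z.2.2.1)) h
    have hprod := prOf_output (p := p) hW t g (g (z.1, z.2.1, z.2.2.1)) (z.2.2.2 t)
      (W (z.2.1 t, z.2.2.1 t) (z.2.2.2 t)) fun b hb => by
        obtain ⟨e1, e2⟩ := hg _ _ hb
        rw [e1, e2]
    rw [← prOf_input hW] at hprod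
    rw [hprod] at h1 ⊢
    rw [Real.logb_mul h2.ne' (right_ne_zero_of_mul h1.ne')]
    ring

theorem ent_input_output (hW : ∀ x, IsPmf (W x)) (hp : IsPmf p) :
    ent (jointWithOutput W n p) (fun z => z) =
      ent (jointWithOutput W n p) (fun z => (z.1, z.2.1, z.2.2.1)) -
        ∑ t, ∑ z, jointWithOutput W n p z *
          Real.logb 2 (W (z.2.1 t, z.2.2.1 t) (z.2.2.2 t)) := by
  have hq := isPmf_jointWithOutput hW hp
  rw [Finset.sum_comm]
  simp only [ent, prOf_jointWithOutput hW, ← Finset.sum_neg_distrib, ← Finset.sum_sub_distrib,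
    ← Finset.mul_sum]
  refine Finset.sum_congr rfl fun z _ => ?_
  rcases (hq.1 z).eq_or_lt with h | h
  · simp [← h]
  · have hself : prOf (jointWithOutput W n p) (fun z => z) z = jointWithOutput W n p z := by
      rw [prOf, Finset.sum_eq_single z] <;> simp +contextual
    have hne := h.ne'
    rw [hself]
    rw [jointWithOutput] at hne
    conv_lhs => rw [jointWithOutput]
    rw [Real.logb_mul (left_ne_zero_of_mul hne) (right_ne_zero_of_mul hne),
      Real.logb_prod _ _ (Finset.prod_ne_zero_iff.1 (right_ne_zero_of_mul hne))]
    simp only [jointWithOutput]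
    ring

theorem condMutualInfo_le_sum (hW : ∀ x, IsPmf (W x)) (hp : IsPmf p)
    (T : Finset (Fin n)) :
    condMutualInfo (jointWithOutput W n p) (fun z => (z.2.1, z.2.2.1)) (fun z => z.2.2.2)
        (fun z => z.1) ≤
      T.card * Real.logb 2 (Fintype.card 𝒳₁ * Fintype.card 𝒳₂) +
        ∑ t, condMutualInfo (jointWithOutput W n p) (fun z => (z.2.1 t, z.2.2.1 t))
          (fun z => z.2.2.2 t) (fun z => (z.1, mask T z.2.1, mask T z.2.2.1)) := by
  have hq := isPmf_jointWithOutput hW hp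
  simp only [condMutualInfo_eq_ent hq.1]
  set q := jointWithOutput W n p with hqdef
  let V := fun z : 𝒰 × (Fin n → 𝒳₁) × (Fin n → 𝒳₂) × (Fin n → 𝒴) =>
    (z.1, mask T z.2.1, mask T z.2.2.1)
  have hmono : ent q (fun z => (z.2.2.2, z.1)) ≤
      ent q (fun z => (mask Finset.univ z.2.2.2, V z)) :=
    ent_le_ent hq.1 (by simp +contextual [mask_eq_iff, V, ← funext_iff])
  have hY := ent_mask_le hq (fun z => z.2.2.2) V Finset.univ
  have hV := ent_mask_le hq (fun z t => (z.2.1 t, z.2.2.1 t)) (fun z => z.1) T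
  rw [ent_congr hq.1 (B := V) (by simp [mask_eq_iff, V, forall_and]; tauto)] at hV
  have hcard : ∑ t ∈ T, (ent q (fun z => ((z.2.1 t, z.2.2.1 t), z.1)) - ent q (fun z => z.1)) ≤
      T.card * Real.logb 2 (Fintype.card 𝒳₁ * Fintype.card 𝒳₂) := by
    rw [← nsmul_eq_mul]
    refine Finset.sum_le_card_nsmul _ _ _ fun t _ => ?_
    have := ent_pair_le_card hq (fun z => (z.2.1 t, z.2.2.1 t)) (fun z => z.1)
    rw [Fintype.card_prod, Nat.cast_mul] at this
    linarith
  have hXY := ent_input_output hW hp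
  rw [← hqdef, ent_congr hq.1 (A := fun z => z)
      (B := fun z => ((z.2.1, z.2.2.1), z.2.2.2, z.1)) (by simp [Prod.ext_iff]; tauto),
    ent_congr hq.1 (A := fun z => (z.1, z.2.1, z.2.2.1))
      (B := fun z => ((z.2.1, z.2.2.1), z.1)) (by simp; tauto)] at hXY
  have hout : ∀ t, ent q (fun z => ((z.2.1 t, z.2.2.1 t), z.2.2.2 t, V z)) =
      ent q (fun z => ((z.2.1 t, z.2.2.1 t), V z)) -
        ∑ z, q z * Real.logb 2 (W (z.2.1 t, z.2.2.1 t) (z.2.2.2 t)) := fun t => by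
    rw [← ent_output hW hp t
      (fun b => ((b.2.1 t, b.2.2 t), (b.1, mask T b.2.1, mask T b.2.2)))
      (by simp +contextual)]
    exact ent_congr hq.1 (by simp [V]; tauto)
  simp only [V] at hout hY hV hmono
  simp only [hout, Finset.sum_sub_distrib, Finset.sum_add_distrib] at hXY hY hV hcard ⊢
  linarith

theorem bddAbove_sigman_set (hW : ∀ x, IsPmf (W x)) (n : ℕ) (δ : ℝ) :
    BddAbove {r : ℝ | ∃ (k : ℕ) (p : Fin k × (Fin n → 𝒳₁) × (Fin n → 𝒳₂) → ℝ),
      IsPmf p ∧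
      condMutualInfo p (fun z => z.2.1) (fun z => z.2.2) (fun z => z.1) ≤ n * δ ∧
      r = (1 / n) * condMutualInfo (jointWithOutput W n p)
        (fun z => (z.2.1, z.2.2.1)) (fun z => z.2.2.2) (fun z => z.1)} := by
  refine ⟨(1 / n) * Real.logb 2 (Fintype.card ((Fin n → 𝒳₁) × (Fin n → 𝒳₂))), ?_⟩
  rintro r ⟨k, p, hp, -, rfl⟩
  exact mul_le_mul_of_nonneg_left (condMutualInfo_le_card (isPmf_jointWithOutput hW hp) _ _ _)
    (by positivity)

theorem sigman_nonneg (hW : ∀ x, IsPmf (W x)) (n : ℕ) (δ : ℝ) : 0 ≤ sigman W n δ := by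
  refine Real.sSup_nonneg ?_
  rintro r ⟨k, p, hp, -, rfl⟩
  exact mul_nonneg (by positivity) (condMutualInfo_nonneg (isPmf_jointWithOutput hW hp) _ _ _)

theorem condMutualInfo_le_sigman_one {ν : Type*} [Fintype ν] (hW : ∀ x, IsPmf (W x))
    (hp : IsPmf p) (t : Fin n) (v : 𝒰 × (Fin n → 𝒳₁) × (Fin n → 𝒳₂) → ν) {ε : ℝ}
    (hε : condMutualInfo (jointWithOutput W n p) (fun z => z.2.1 t) (fun z => z.2.2.1 t)
      (fun z => v (z.1, z.2.1, z.2.2.1)) ≤ ε) :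
    condMutualInfo (jointWithOutput W n p) (fun z => (z.2.1 t, z.2.2.1 t)) (fun z => z.2.2.2 t)
      (fun z => v (z.1, z.2.1, z.2.2.1)) ≤ sigman W 1 ε := by
  have hq := isPmf_jointWithOutput hW hp
  let g : 𝒰 × (Fin n → 𝒳₁) × (Fin n → 𝒳₂) →
      Fin (Fintype.card ν) × (Fin 1 → 𝒳₁) × (Fin 1 → 𝒳₂) :=
    fun b => (Fintype.equivFin ν (v b), fun _ => b.2.1 t, fun _ => b.2.2 t)
  have hjoint : jointWithOutput W 1 (prOf p g) =
      prOf (jointWithOutput W n p) (fun z => ((g (z.1, z.2.1, z.2.2.1)).1,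
        (g (z.1, z.2.1, z.2.2.1)).2.1, (g (z.1, z.2.1, z.2.2.1)).2.2,
        fun _ : Fin 1 => z.2.2.2 t)) := by
    funext ⟨k, a, b, y⟩
    have hout := prOf_output (p := p) hW t g (k, a, b) (y 0) (W (a 0, b 0) (y 0))
      (by rintro x hx; simp only [g, Prod.mk.injEq] at hx; rw [← hx.2.1, ← hx.2.2])
    simp only [jointWithOutput, Finset.univ_unique, Fin.default_eq_zero, Finset.prod_singleton]
    rw [← hout]
    refine prOf_congr _ fun z => ?_
    simp [g, funext_iff, and_assoc]
  refine le_csSup (bddAbove_sigman_set hW 1 ε)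
    ⟨Fintype.card ν, prOf p g, isPmf_prOf hp g, ?_, ?_⟩
  · have hg : prOf p g = prOf (jointWithOutput W n p) (fun z => g (z.1, z.2.1, z.2.2.1)) :=
      funext fun m => (prOf_input hW g m).symm
    rw [hg, condMutualInfo_prOf, Nat.cast_one, one_mul]
    refine le_of_eq_of_le (condMutualInfo_congr hq.1 ?_ ?_ ?_) hε <;> simp [g, funext_iff]
  · rw [hjoint, condMutualInfo_prOf, Nat.cast_one, div_one, one_mul]
    refine condMutualInfo_congr hq.1 ?_ ?_ ?_ <;> simp [g, funext_iff]

end Channel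

/-- The single-letterization bound `σ(δ) ≤ (δ/ε)·log₂(|𝒳₁||𝒳₂|) + σ₁(ε)`, where
`σ(δ) = sup_{n ≥ 1} σ_n(δ)`. -/
theorem sigma_le_single_letter (W : 𝒳₁ × 𝒳₂ → 𝒴 → ℝ) (hW : ∀ x, IsPmf (W x))
    (ε δ : ℝ) (hε : 0 < ε) (hδ : 0 < δ) :
    (⨆ n : ℕ, sigman W (n + 1) δ) ≤
      δ / ε * Real.logb 2 (Fintype.card 𝒳₁ * Fintype.card 𝒳₂) + sigman W 1 ε := by

  have hL : 0 ≤ Real.logb 2 ((Fintype.card 𝒳₁ : ℝ) * Fintype.card 𝒳₂) := by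
    rw [Real.logb, ← Nat.cast_mul]
    exact div_nonneg (Real.log_natCast_nonneg _) (Real.log_nonneg one_le_two)
  have hσ := sigman_nonneg hW 1 ε
  refine ciSup_le fun m => Real.sSup_le ?_ (by positivity)
  rintro r ⟨k, p, hp, hI, rfl⟩
  have hn : (0 : ℝ) < (m + 1 : ℕ) := by positivity
  have hq := isPmf_jointWithOutput hW hp
  rw [← prOf_jointWithOutput (p := p) hW, condMutualInfo_prOf] at hI
  obtain ⟨T, hT, hTε⟩ := exists_wringing_set hq (fun z => z.2.1) (fun z => z.2.2.1)
    (fun z => z.1) hε hI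
  have hsum := Finset.sum_le_card_nsmul Finset.univ _ (sigman W 1 ε) fun t _ =>
    condMutualInfo_le_sigman_one hW hp t (fun b => (b.1, mask T b.2.1, mask T b.2.2)) (hTε t)
  rw [Finset.card_univ, Fintype.card_fin, nsmul_eq_mul] at hsum
  have hmain := (condMutualInfo_le_sum hW hp T).trans (add_le_add_right hsum _)
  have hcard : (T.card : ℝ) ≤ (m + 1 : ℕ) * (δ / ε) := by
    rw [← mul_div_assoc, le_div_iff₀ hε]
    exact hT
  have hbad := mul_le_mul_of_nonneg_right hcard hL
  rw [one_div, inv_mul_le_iff₀ hn]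
  linarith
end

section
/- The single-letter function σ₁(δ) = sup_{|𝒰|≤2} max over p(u,x₁,x₂) with I(X₁;X₂|U) ≤ δ of I(X₁,X₂;Y|U) is continuous at δ = 0; more precisely, for all δ > 0 with √(2δ ln 2) < |𝒴|/e, σ₁(δ) ≤ σ₁(0) + √(2δ ln 2)·log₂(|𝒴|³/√(2δ ln 2)) + √(2δ ln 2)·log₂|𝒴|. -/
open scoped BigOperators Classical

variable {𝒳₁ 𝒳₂ 𝒴 : Type} [Fintype 𝒳₁] [Fintype 𝒳₂] [Fintype 𝒴]

/-- The single-letter function `σ₁(δ)`, with the auxiliary alphabet restricted to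
cardinality at most 2: the supremum of `I(X₁,X₂;Y|U)` over joint pmfs `p(u,x₁,x₂)`
with `I(X₁;X₂|U) ≤ δ`. -/
noncomputable def sigmaOne (W : 𝒳₁ × 𝒳₂ → 𝒴 → ℝ) (δ : ℝ) : ℝ :=
  sSup {r : ℝ | ∃ (k : ℕ) (_ : k ≤ 2) (p : Fin k × 𝒳₁ × 𝒳₂ → ℝ),
    IsPmf p ∧
    condMutualInfo p (fun z => z.2.1) (fun z => z.2.2) (fun z => z.1) ≤ δ ∧
    r = condMutualInfo
      (fun z : Fin k × 𝒳₁ × 𝒳₂ × 𝒴 =>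
        p (z.1, z.2.1, z.2.2.1) * W (z.2.1, z.2.2.1) z.2.2.2)
      (fun z => (z.2.1, z.2.2.1)) (fun z => z.2.2.2) (fun z => z.1)}

theorem hasDerivAt_log_sub_rational {x : ℝ} (hx : 0 < x) :
    HasDerivAt (fun x : ℝ => Real.log x - (x - 1) * (5 * x + 1) / (2 * x * (x + 2)))
      ((x - 1) ^ 3 / (x ^ 2 * (x + 2) ^ 2)) x := by
  have h1 := Real.hasDerivAt_log hx.ne'
  have hnum : HasDerivAt (fun x : ℝ => (x - 1) * (5 * x + 1)) (10 * x - 4) x := by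
    have := ((hasDerivAt_id x).sub_const 1).mul (((hasDerivAt_id x).const_mul 5).add_const 1)
    exact this.congr_deriv (by simp; ring)
  have hden : HasDerivAt (fun x : ℝ => 2 * x * (x + 2)) (4 * x + 4) x := by
    have := ((hasDerivAt_id x).const_mul 2).mul ((hasDerivAt_id x).add_const 2)
    exact this.congr_deriv (by simp; ring)
  refine (h1.sub (hnum.div hden (by positivity))).congr_deriv ?_
  field_simp
  ring

theorem rational_le_log {x : ℝ} (hx : 0 < x) :
    (x - 1) * (5 * x + 1) / (2 * x * (x + 2)) ≤ Real.log x := by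
  set φ : ℝ → ℝ := fun x => Real.log x - (x - 1) * (5 * x + 1) / (2 * x * (x + 2)) with hφ
  have hφ1 : φ 1 = 0 := by simp [hφ]
  suffices h : φ 1 ≤ φ x by
    rw [hφ1] at h
    exact sub_nonneg.mp h
  rcases le_total 1 x with h | h
  · have hpos : ∀ y ∈ Set.Icc 1 x, (0 : ℝ) < y := fun y hy => by linarith [hy.1]
    refine monotoneOn_of_deriv_nonneg (convex_Icc 1 x)
      (fun y hy => (hasDerivAt_log_sub_rational (hpos y hy)).continuousAt.continuousWithinAt)
      (fun y hy => (hasDerivAt_log_sub_rational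
        (hpos y (interior_subset hy))).differentiableAt.differentiableWithinAt)
      (fun y hy => ?_) (Set.left_mem_Icc.mpr h) (Set.right_mem_Icc.mpr h) h
    rw [(hasDerivAt_log_sub_rational (hpos y (interior_subset hy))).deriv]
    have : 0 ≤ y - 1 := sub_nonneg.mpr (interior_subset hy).1
    positivity
  · have hpos : ∀ y ∈ Set.Icc x 1, (0 : ℝ) < y := fun y hy => hx.trans_le hy.1
    refine antitoneOn_of_deriv_nonpos (convex_Icc x 1)
      (fun y hy => (hasDerivAt_log_sub_rational (hpos y hy)).continuousAt.continuousWithinAt)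
      (fun y hy => (hasDerivAt_log_sub_rational
        (hpos y (interior_subset hy))).differentiableAt.differentiableWithinAt)
      (fun y hy => ?_) (Set.left_mem_Icc.mpr h) (Set.right_mem_Icc.mpr h) h
    rw [(hasDerivAt_log_sub_rational (hpos y (interior_subset hy))).deriv]
    have : y - 1 ≤ 0 := sub_nonpos.mpr (interior_subset hy).2
    exact div_nonpos_of_nonpos_of_nonneg (Odd.pow_nonpos (by decide) this) (by positivity)

theorem sq_sub_le_mul_klTerm {p q : ℝ} (hp : 0 ≤ p) (hq : 0 ≤ q) (hpq : q = 0 → p = 0) :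
    (p - q) ^ 2 ≤ (2 * p + 4 * q) / 3 * (p * Real.log (p / q) - p + q) := by
  rcases hp.eq_or_lt with rfl | hp
  · simp; nlinarith [sq_nonneg q]
  have hq : 0 < q := hq.lt_of_ne fun h => hp.ne' (hpq h.symm)
  have h := rational_le_log (div_pos hp hq)
  have e : (p / q - 1) * (5 * (p / q) + 1) / (2 * (p / q) * (p / q + 2))
      = (p - q) * (5 * p + q) / (2 * p * (p + 2 * q)) := by
    field_simp
  rw [e, div_le_iff₀ (by positivity)] at h
  linarith [h]

/-- Pinsker's inequality on a finite space, in nats. -/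
theorem sq_sum_abs_sub_le_two_mul_kl {ι : Type*} [Fintype ι] {p q : ι → ℝ}
    (hp : IsPmf p) (hq : IsPmf q) (hpq : ∀ i, q i = 0 → p i = 0) :
    (∑ i, |p i - q i|) ^ 2 ≤ 2 * ∑ i, p i * Real.log (p i / q i) := by
  have h0 : ∀ i, 0 ≤ p i * Real.log (p i / q i) - p i + q i := fun i => by
    have := sq_sub_le_mul_klTerm (hp.1 i) (hq.1 i) (hpq i)
    rcases (hq.1 i).eq_or_lt with h | h
    · simp [hpq i h.symm, ← h]
    · have h2 : 0 < (2 * p i + 4 * q i) / 3 := by linarith [hp.1 i]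
      exact nonneg_of_mul_nonneg_right ((sq_nonneg _).trans this) h2
  have h := Finset.sum_sq_le_sum_mul_sum_of_sq_le_mul Finset.univ
    (r := fun i => |p i - q i|) (f := fun i => (2 * p i + 4 * q i) / 3)
    (g := fun i => p i * Real.log (p i / q i) - p i + q i)
    (fun i _ => by linarith [hp.1 i, hq.1 i]) (fun i _ => h0 i)
    (fun i _ => by rw [sq_abs]; exact sq_sub_le_mul_klTerm (hp.1 i) (hq.1 i) (hpq i))
  refine h.trans_eq ?_
  rw [← Finset.sum_div, Finset.sum_add_distrib, ← Finset.mul_sum, ← Finset.mul_sum,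
    Finset.sum_add_distrib, Finset.sum_sub_distrib, hp.2, hq.2]
  ring

theorem negMulLog_le_tangent {t c : ℝ} (ht : 0 ≤ t) (hc : 0 < c) :
    Real.negMulLog t ≤ c - t - t * Real.log c := by
  rcases ht.eq_or_lt with rfl | ht
  · simpa using hc.le
  have h := Real.log_le_sub_one_of_pos (div_pos hc ht)
  rw [Real.log_div hc.ne' ht.ne'] at h
  have := mul_le_mul_of_nonneg_left h ht.le
  rw [mul_sub, mul_sub, mul_div_cancel₀ _ ht.ne'] at this
  rw [Real.negMulLog]
  linarith

theorem negMulLog_sub_le {a b : ℝ} (ha : 0 ≤ a) (hb : 0 ≤ b) (hb1 : b ≤ 1) :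
    Real.negMulLog a - Real.negMulLog b ≤ Real.negMulLog (max (a - b) 0) + max (b - a) 0 := by
  rcases le_total a b with h | h
  · rw [max_eq_right (by linarith), max_eq_left (by linarith)]
    rcases hb.eq_or_lt with rfl | hb
    · simp [le_antisymm h ha]
    have h1 := negMulLog_le_tangent ha hb
    have h2 : (b - a) * Real.log b ≤ 0 :=
      mul_nonpos_of_nonneg_of_nonpos (by linarith) (Real.log_nonpos hb.le hb1)
    simp only [Real.negMulLog, neg_mul, zero_mul, neg_zero] at h1 ⊢
    linarith
  · rw [max_eq_left (by linarith), max_eq_right (by linarith)]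
    rcases hb.eq_or_lt with rfl | hb
    · simp
    rcases h.eq_or_lt with rfl | h
    · simp
    have h1 := Real.log_le_log hb h.le
    have h2 := Real.log_le_log (sub_pos.mpr h) (by linarith : a - b ≤ a)
    simp only [Real.negMulLog]
    nlinarith [mul_le_mul_of_nonneg_left h1 hb.le,
      mul_le_mul_of_nonneg_left h2 (sub_pos.mpr h).le]

/-- One-sided `L¹` continuity of the entropy. -/
theorem sum_negMulLog_sub_le {ι : Type*} [Fintype ι] {a b : ι → ℝ} (ha : IsPmf a)
    (hb : IsPmf b) {s N : ℝ} (hs : 0 < s) (hsN : s ≤ 2 * N) (hN : (Fintype.card ι : ℝ) ≤ N)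
    (hab : ∑ i, |a i - b i| ≤ s) :
    ∑ i, (Real.negMulLog (a i) - Real.negMulLog (b i))
      ≤ s / 2 * (Real.log (2 * N / s) + 1) := by
  have hN0 : 0 < N := by linarith
  have hT : ∑ i, max (a i - b i) 0 = ∑ i, max (b i - a i) 0 := by
    rw [← sub_eq_zero, ← Finset.sum_sub_distrib]
    have : ∀ i, max (a i - b i) 0 - max (b i - a i) 0 = a i - b i := fun i => by
      rcases le_total (a i) (b i) with h | h
      · rw [max_eq_right (by linarith), max_eq_left (by linarith)]; ring
      · rw [max_eq_left (by linarith), max_eq_right (by linarith)]; ring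
    simp [this, ha.2, hb.2]
  have hT2 : ∑ i, max (a i - b i) 0 + ∑ i, max (b i - a i) 0 ≤ s := by
    rw [← Finset.sum_add_distrib]
    refine le_trans (Finset.sum_le_sum fun i _ => ?_) hab
    rcases le_total (a i) (b i) with h | h
    · rw [max_eq_right (by linarith), max_eq_left (by linarith), abs_of_nonpos (by linarith)]
      linarith
    · rw [max_eq_left (by linarith), max_eq_right (by linarith), abs_of_nonneg (by linarith)]
      linarith
  set T := ∑ i, max (a i - b i) 0 with hTdef
  have hc : 0 < s / (2 * N) := by positivity
  have hlog : Real.log (s / (2 * N)) = - Real.log (2 * N / s) := by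
    rw [← Real.log_inv, inv_div]
  have hlog0 : 0 ≤ Real.log (2 * N / s) := Real.log_nonneg ((one_le_div hs).mpr hsN)
  have hcard : (Fintype.card ι : ℝ) * (s / (2 * N)) ≤ s / 2 := by
    calc _ ≤ N * (s / (2 * N)) := by gcongr
      _ = s / 2 := by field_simp
  have hb1 : ∀ i, b i ≤ 1 := fun i =>
    hb.2 ▸ Finset.single_le_sum (fun j _ => hb.1 j) (Finset.mem_univ i)
  calc ∑ i, (Real.negMulLog (a i) - Real.negMulLog (b i))
      ≤ ∑ i, ((s / (2 * N) - max (a i - b i) 0 - max (a i - b i) 0 * Real.log (s / (2 * N)))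
          + max (b i - a i) 0) := Finset.sum_le_sum fun i _ =>
        (negMulLog_sub_le (ha.1 i) (hb.1 i) (hb1 i)).trans
          (by gcongr; exact negMulLog_le_tangent (le_max_right _ _) hc)
    _ = Fintype.card ι * (s / (2 * N)) + T * Real.log (2 * N / s) := by
        rw [Finset.sum_add_distrib, Finset.sum_sub_distrib, Finset.sum_sub_distrib,
          ← Finset.sum_mul, ← hT, hlog]
        simp [← hTdef]
        ring
    _ ≤ s / 2 * (Real.log (2 * N / s) + 1) := by
        have : T * Real.log (2 * N / s) ≤ s / 2 * Real.log (2 * N / s) :=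
          mul_le_mul_of_nonneg_right (by linarith) hlog0
        linarith

/-- The pmf with the same marginals on `(U, X₁)` and `(U, X₂)` as `p` under which `X₁` and `X₂`
are conditionally independent given `U`. -/
noncomputable def condProd {U A B : Type*} [Fintype A] [Fintype B] (p : U × A × B → ℝ)
    (z : U × A × B) : ℝ :=
  (∑ b, p (z.1, z.2.1, b)) * (∑ a, p (z.1, a, z.2.2)) / ∑ a, ∑ b, p (z.1, a, b)

/-- The joint pmf of the auxiliary variable and the channel output. -/
def outputPmf {U X Y : Type*} [Fintype X] (W : X → Y → ℝ) (p : U × X → ℝ) (z : U × Y) : ℝ :=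
  ∑ x, p (z.1, x) * W x z.2

section

variable {U A B X Y : Type*} [Fintype A] [Fintype B] [Fintype X] [Fintype Y]

theorem eq_zero_of_sum_sum_eq_zero {p : U × A × B → ℝ} (hp : ∀ z, 0 ≤ p z) {u : U}
    (h : ∑ a, ∑ b, p (u, a, b) = 0) (a : A) (b : B) : p (u, a, b) = 0 := by
  rw [← Fintype.sum_prod_type (fun x => p (u, x)),
    Fintype.sum_eq_zero_iff_of_nonneg fun x => hp (u, x)] at h
  exact congrFun h (a, b)

theorem sum_snd_condProd {p : U × A × B → ℝ} (hp : ∀ z, 0 ≤ p z) (u : U) (a : A) :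
    ∑ b, condProd p (u, a, b) = ∑ b, p (u, a, b) := by
  simp only [condProd]
  rw [← Finset.sum_div, ← Finset.mul_sum, Finset.sum_comm (f := fun b a => p (u, a, b))]
  by_cases h : ∑ a, ∑ b, p (u, a, b) = 0
  · simp [eq_zero_of_sum_sum_eq_zero hp h]
  · exact mul_div_cancel_right₀ _ h

theorem sum_fst_condProd {p : U × A × B → ℝ} (hp : ∀ z, 0 ≤ p z) (u : U) (b : B) :
    ∑ a, condProd p (u, a, b) = ∑ a, p (u, a, b) := by
  simp only [condProd]
  rw [← Finset.sum_div, ← Finset.sum_mul]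
  by_cases h : ∑ a, ∑ b, p (u, a, b) = 0
  · simp [eq_zero_of_sum_sum_eq_zero hp h]
  · exact mul_div_cancel_left₀ _ h

theorem sum_condProd {p : U × A × B → ℝ} (hp : ∀ z, 0 ≤ p z) (u : U) :
    ∑ x, condProd p (u, x) = ∑ x, p (u, x) := by
  simp only [Fintype.sum_prod_type, sum_snd_condProd hp]

theorem condProd_condProd {p : U × A × B → ℝ} (hp : ∀ z, 0 ≤ p z) :
    condProd (condProd p) = condProd p := by
  funext z
  rw [condProd]
  simp only [sum_snd_condProd hp, sum_fst_condProd hp]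
  rfl

theorem eq_zero_of_condProd_eq_zero {p : U × A × B → ℝ} (hp : ∀ z, 0 ≤ p z) (z : U × A × B)
    (h : condProd p z = 0) : p z = 0 := by
  obtain ⟨u, a, b⟩ := z
  simp only [condProd, div_eq_zero_iff, mul_eq_zero] at h
  rcases h with (h | h) | h
  · exact congrFun ((Fintype.sum_eq_zero_iff_of_nonneg fun b => hp (u, a, b)).mp h) b
  · exact congrFun ((Fintype.sum_eq_zero_iff_of_nonneg fun a => hp (u, a, b)).mp h) a
  · exact eq_zero_of_sum_sum_eq_zero hp h a b

theorem sum_outputPmf {W : X → Y → ℝ} (hW : ∀ x, IsPmf (W x)) (p : U × X → ℝ) (u : U) :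
    ∑ y, outputPmf W p (u, y) = ∑ x, p (u, x) := by
  simp only [outputPmf]
  rw [Finset.sum_comm]
  simp [← Finset.mul_sum, (hW _).2]

variable [Fintype U]

theorem condMutualInfo_eq_kl_condProd (p : U × A × B → ℝ) :
    condMutualInfo p (fun z => z.2.1) (fun z => z.2.2) (fun z => z.1)
      = (∑ z, p z * Real.log (p z / condProd p z)) / Real.log 2 := by
  have h1 : ∀ a b c, prOf p (fun z => (z.2.1, z.2.2, z.1)) (a, b, c) = p (c, a, b) := by
    intro a b c
    simp [prOf, Fintype.sum_prod_type, Prod.ext_iff, ite_and]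
  have h2 : ∀ c, prOf p (fun z => z.1) c = ∑ a, ∑ b, p (c, a, b) := by
    intro c
    simp only [prOf, Fintype.sum_prod_type]
    rw [Finset.sum_eq_single c (fun u _ hu => by simp [hu]) (by simp)]
    simp
  have h3 : ∀ a c, prOf p (fun z => (z.2.1, z.1)) (a, c) = ∑ b, p (c, a, b) := by
    intro a c
    simp only [prOf, Fintype.sum_prod_type, Prod.mk.injEq]
    rw [Finset.sum_eq_single c (fun u _ hu => by simp [hu]) (by simp),
      Finset.sum_eq_single a (fun u _ hu => by simp [hu]) (by simp)]
    simp
  have h4 : ∀ b c, prOf p (fun z => (z.2.2, z.1)) (b, c) = ∑ a, p (c, a, b) := by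
    intro b c
    simp only [prOf, Fintype.sum_prod_type, Prod.mk.injEq]
    rw [Finset.sum_eq_single c (fun u _ hu => by simp [hu]) (by simp)]
    simp
  simp only [condMutualInfo, h1, h2, h3, h4, Real.logb, Finset.sum_div, Fintype.sum_prod_type,
    condProd, div_div_eq_mul_div, ← mul_div_assoc]
  rw [Finset.sum_comm (s := (Finset.univ : Finset U))]
  exact Finset.sum_congr rfl fun a _ => Finset.sum_comm

theorem isPmf_condProd {p : U × A × B → ℝ} (hp : IsPmf p) : IsPmf (condProd p) := by
  refine ⟨fun z => div_nonneg (mul_nonneg (Finset.sum_nonneg fun _ _ => hp.1 _)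
    (Finset.sum_nonneg fun _ _ => hp.1 _))
    (Finset.sum_nonneg fun _ _ => Finset.sum_nonneg fun _ _ => hp.1 _), ?_⟩
  rw [← hp.2, Fintype.sum_prod_type, Fintype.sum_prod_type]
  exact Finset.sum_congr rfl fun u _ => sum_condProd hp.1 u

theorem condMutualInfo_condProd {p : U × A × B → ℝ} (hp : ∀ z, 0 ≤ p z) :
    condMutualInfo (condProd p) (fun z => z.2.1) (fun z => z.2.2) (fun z => z.1) = 0 := by
  rw [condMutualInfo_eq_kl_condProd, condProd_condProd hp]
  simp

theorem sum_abs_sub_condProd_le {p : U × A × B → ℝ} (hp : IsPmf p) {δ : ℝ}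
    (h : condMutualInfo p (fun z => z.2.1) (fun z => z.2.2) (fun z => z.1) ≤ δ) :
    ∑ z, |p z - condProd p z| ≤ Real.sqrt (2 * δ * Real.log 2) := by
  rw [condMutualInfo_eq_kl_condProd, div_le_iff₀ (Real.log_pos one_lt_two)] at h
  refine Real.le_sqrt_of_sq_le ((sq_sum_abs_sub_le_two_mul_kl hp (isPmf_condProd hp)
    (eq_zero_of_condProd_eq_zero hp.1)).trans ?_)
  linarith

theorem isPmf_outputPmf {W : X → Y → ℝ} (hW : ∀ x, IsPmf (W x)) {p : U × X → ℝ}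
    (hp : IsPmf p) : IsPmf (outputPmf W p) := by
  refine ⟨fun z => Finset.sum_nonneg fun x _ => mul_nonneg (hp.1 _) ((hW x).1 _), ?_⟩
  rw [← hp.2, Fintype.sum_prod_type, Fintype.sum_prod_type]
  exact Finset.sum_congr rfl fun u _ => sum_outputPmf hW p u

theorem sum_abs_outputPmf_sub_le {W : X → Y → ℝ} (hW : ∀ x, IsPmf (W x)) (p q : U × X → ℝ) :
    ∑ z, |outputPmf W p z - outputPmf W q z| ≤ ∑ z, |p z - q z| := by
  simp only [Fintype.sum_prod_type]
  refine Finset.sum_le_sum fun u _ => ?_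
  calc ∑ y, |outputPmf W p (u, y) - outputPmf W q (u, y)|
      ≤ ∑ y, ∑ x, |p (u, x) - q (u, x)| * W x y := Finset.sum_le_sum fun y _ => by
        simp only [outputPmf, ← Finset.sum_sub_distrib, ← sub_mul]
        refine (Finset.abs_sum_le_sum_abs _ _).trans_eq (Finset.sum_congr rfl fun x _ => ?_)
        rw [abs_mul, abs_of_nonneg ((hW x).1 y)]
    _ = ∑ x, |p (u, x) - q (u, x)| := by
        rw [Finset.sum_comm]
        simp [← Finset.mul_sum, (hW _).2]

theorem condMutualInfo_channel_eq {W : A × B → Y → ℝ} (hW : ∀ x, IsPmf (W x))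
    {p : U × A × B → ℝ} (hp : IsPmf p) :
    condMutualInfo
      (fun z : U × A × B × Y => p (z.1, z.2.1, z.2.2.1) * W (z.2.1, z.2.2.1) z.2.2.2)
      (fun z => (z.2.1, z.2.2.1)) (fun z => z.2.2.2) (fun z => z.1)
    = (∑ z, Real.negMulLog (outputPmf W p z) - ∑ u, Real.negMulLog (∑ x, p (u, x))
        - ∑ z, p z * ∑ y, Real.negMulLog (W z.2 y)) / Real.log 2 := by
  set r := fun z : U × A × B × Y => p (z.1, z.2.1, z.2.2.1) * W (z.2.1, z.2.2.1) z.2.2.2 with hr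
  have h1 : ∀ x y c, prOf r (fun z => ((z.2.1, z.2.2.1), z.2.2.2, z.1)) (x, y, c)
      = p (c, x) * W x y := by
    rintro ⟨a, b⟩ y c
    simp [prOf, Fintype.sum_prod_type, Prod.ext_iff, ite_and, hr]
  have h2 : ∀ c, prOf r (fun z => z.1) c = ∑ x, p (c, x) := by
    intro c
    simp only [prOf, Fintype.sum_prod_type]
    rw [Finset.sum_eq_single c (fun u _ hu => by simp [hu]) (by simp)]
    simp [hr, ← Finset.mul_sum, (hW _).2]
  have h3 : ∀ x c, prOf r (fun z => ((z.2.1, z.2.2.1), z.1)) (x, c) = p (c, x) := by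
    rintro ⟨a, b⟩ c
    simp only [prOf, Fintype.sum_prod_type, Prod.mk.injEq]
    rw [Finset.sum_eq_single c (fun u _ hu => by simp [hu]) (by simp),
      Finset.sum_eq_single a (fun u _ hu => by simp [hu]) (by simp),
      Finset.sum_eq_single b (fun u _ hu => by simp [hu]) (by simp)]
    simp [hr, ← Finset.mul_sum, (hW _).2]
  have h4 : ∀ y c, prOf r (fun z => (z.2.2.2, z.1)) (y, c) = outputPmf W p (c, y) := by
    intro y c
    simp only [prOf, Fintype.sum_prod_type, Prod.mk.injEq]
    rw [Finset.sum_eq_single c (fun u _ hu => by simp [hu]) (by simp)]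
    simp [hr, outputPmf, Fintype.sum_prod_type]
  have hterm : ∀ x y c, p (c, x) * W x y *
      Real.log (p (c, x) * W x y * (∑ x, p (c, x)) / (p (c, x) * outputPmf W p (c, y)))
      = - (p (c, x) * Real.negMulLog (W x y)) + p (c, x) * W x y * Real.log (∑ x, p (c, x))
        - p (c, x) * W x y * Real.log (outputPmf W p (c, y)) := by
    intro x y c
    rcases (hp.1 (c, x)).eq_or_lt with h | h
    · simp [← h]
    rcases ((hW x).1 y).eq_or_lt with h' | h'
    · simp [← h']
    have e1 : 0 < ∑ x, p (c, x) :=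
      Finset.sum_pos' (fun x _ => hp.1 _) ⟨x, Finset.mem_univ _, h⟩
    have e2 : 0 < outputPmf W p (c, y) :=
      Finset.sum_pos' (fun x _ => mul_nonneg (hp.1 _) ((hW x).1 _))
        ⟨x, Finset.mem_univ _, mul_pos h h'⟩
    rw [Real.log_div (by positivity) (by positivity), Real.log_mul (by positivity) e1.ne',
      Real.log_mul h.ne' h'.ne', Real.log_mul h.ne' e2.ne', Real.negMulLog]
    ring
  have hsum : ∀ c, ∑ x, ∑ y, p (c, x) * W x y *
      Real.log (p (c, x) * W x y * (∑ x, p (c, x)) / (p (c, x) * outputPmf W p (c, y)))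
      = ∑ y, Real.negMulLog (outputPmf W p (c, y)) - Real.negMulLog (∑ x, p (c, x))
        - ∑ x, p (c, x) * ∑ y, Real.negMulLog (W x y) := by
    intro c
    simp only [hterm, Finset.sum_sub_distrib, Finset.sum_add_distrib, Finset.sum_neg_distrib]
    have e1 : ∑ x, ∑ y, p (c, x) * W x y * Real.log (outputPmf W p (c, y))
        = - ∑ y, Real.negMulLog (outputPmf W p (c, y)) := by
      rw [Finset.sum_comm, ← Finset.sum_neg_distrib]
      refine Finset.sum_congr rfl fun y _ => ?_
      rw [← Finset.sum_mul, Real.negMulLog, outputPmf]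
      ring
    have e2 : ∑ x, ∑ y, p (c, x) * W x y * Real.log (∑ x, p (c, x))
        = - Real.negMulLog (∑ x, p (c, x)) := by
      simp only [← Finset.sum_mul, ← Finset.mul_sum, (hW _).2, Real.negMulLog]
      ring
    rw [e1, e2]
    simp only [← Finset.mul_sum]
    ring
  rw [Fintype.sum_prod_type (fun z : U × Y => Real.negMulLog (outputPmf W p z)),
    Fintype.sum_prod_type (fun z : U × A × B => p z * ∑ y, Real.negMulLog (W z.2 y)),
    ← Finset.sum_sub_distrib, ← Finset.sum_sub_distrib, ← Finset.sum_congr rfl fun c _ => hsum c]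
  simp only [condMutualInfo, h1, h2, h3, h4, Real.logb, Finset.sum_div, ← mul_div_assoc]
  rw [Finset.sum_comm (s := (Finset.univ : Finset U))]
  exact Finset.sum_congr rfl fun x _ => Finset.sum_comm

theorem sum_negMulLog_nonneg {w : Y → ℝ} (hw : IsPmf w) : 0 ≤ ∑ y, Real.negMulLog (w y) :=
  Finset.sum_nonneg fun y _ => Real.negMulLog_nonneg (hw.1 y)
    (hw.2 ▸ Finset.single_le_sum (fun j _ => hw.1 j) (Finset.mem_univ y))

theorem sum_negMulLog_le_log_card {w : Y → ℝ} (hw : IsPmf w) (hY : 0 < Fintype.card Y) :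
    ∑ y, Real.negMulLog (w y) ≤ Real.log (Fintype.card Y) := by
  have hY' : (0 : ℝ) < Fintype.card Y := by exact_mod_cast hY
  calc ∑ y, Real.negMulLog (w y)
      ≤ ∑ y, ((Fintype.card Y : ℝ)⁻¹ - w y - w y * Real.log (Fintype.card Y : ℝ)⁻¹) :=
        Finset.sum_le_sum fun y _ => negMulLog_le_tangent (hw.1 y) (inv_pos.mpr hY')
    _ = Real.log (Fintype.card Y) := by
        rw [Finset.sum_sub_distrib, Finset.sum_sub_distrib, ← Finset.sum_mul, hw.2]
        simp [hY'.ne']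

theorem condMutualInfo_channel_le {W : A × B → Y → ℝ} (hW : ∀ x, IsPmf (W x))
    {p : U × A × B → ℝ} (hp : IsPmf p) :
    condMutualInfo
      (fun z : U × A × B × Y => p (z.1, z.2.1, z.2.2.1) * W (z.2.1, z.2.2.1) z.2.2.2)
      (fun z => (z.2.1, z.2.2.1)) (fun z => z.2.2.2) (fun z => z.1)
    ≤ Fintype.card U * Fintype.card Y / Real.log 2 := by
  rw [condMutualInfo_channel_eq hW hp]
  refine div_le_div_of_nonneg_right ?_ (Real.log_pos one_lt_two).le
  have hpu : IsPmf fun u => ∑ x, p (u, x) :=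
    ⟨fun u => Finset.sum_nonneg fun x _ => hp.1 _, by rw [← hp.2, Fintype.sum_prod_type]⟩
  have h1 := sum_negMulLog_nonneg hpu
  have h2 : 0 ≤ ∑ z, p z * ∑ y, Real.negMulLog (W z.2 y) :=
    Finset.sum_nonneg fun z _ => mul_nonneg (hp.1 z) (sum_negMulLog_nonneg (hW _))
  have h3 : ∑ z, Real.negMulLog (outputPmf W p z) ≤ ∑ _z : U × Y, (1 : ℝ) :=
    Finset.sum_le_sum fun z _ => by
      have h := (isPmf_outputPmf hW hp).1 z
      linarith [Real.negMulLog_le_one_sub_self h]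
  simp at h3
  linarith

theorem sum_negMulLog_outputPmf_sub_le {W : X → Y → ℝ} (hW : ∀ x, IsPmf (W x))
    {p q : U × X → ℝ} (hp : IsPmf p) (hq : IsPmf q) (hU : Fintype.card U ≤ 2)
    (hpq : ∀ u, ∑ x, p (u, x) = ∑ x, q (u, x)) {s : ℝ} (hs : 0 < s)
    (hsmall : s < Fintype.card Y / Real.exp 1) (hd : ∑ z, |p z - q z| ≤ s) :
    ∑ z, (Real.negMulLog (outputPmf W p z) - Real.negMulLog (outputPmf W q z))
      ≤ s * Real.log ((Fintype.card Y : ℝ) ^ 3 / s) := by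
  set n : ℝ := (Fintype.card Y : ℝ) with hn
  rw [lt_div_iff₀ (Real.exp_pos 1)] at hsmall
  have hexp : (2 : ℝ) ≤ Real.exp 1 := by linarith [Real.add_one_le_exp (1 : ℝ)]
  have hn0 : 0 < n := lt_trans (by positivity) hsmall
  have hY0 : 1 ≤ Fintype.card Y := Nat.cast_pos.mp (hn ▸ hn0)
  have hn1 : 1 ≤ n := Nat.one_le_cast.mpr hY0
  have hsn : s ≤ n := by nlinarith
  rcases hY0.eq_or_lt with hY | hY
  · obtain ⟨y₀, hy₀⟩ := Fintype.card_eq_one_iff.mp hY.symm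
    have key : ∀ z, outputPmf W p z = outputPmf W q z := by
      rintro ⟨u, y⟩
      have h1 := sum_outputPmf hW p u
      have h2 := sum_outputPmf hW q u
      rw [Fintype.sum_eq_single y fun y' hy' => absurd ((hy₀ y').trans (hy₀ y).symm) hy'] at h1 h2
      rw [h1, h2, hpq]
    simp only [key, sub_self, Finset.sum_const_zero]
    have : 1 ≤ n ^ 3 / s := by
      rw [one_le_div hs]
      exact hsn.trans (le_self_pow₀ hn1 (by norm_num))
    exact mul_nonneg hs.le (Real.log_nonneg this)
  · have hn2 : (2 : ℝ) ≤ n := Nat.ofNat_le_cast.mpr hY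
    have hcard : (Fintype.card (U × Y) : ℝ) ≤ 2 * n := by
      rw [Fintype.card_prod, Nat.cast_mul]
      gcongr
      exact_mod_cast hU
    refine (sum_negMulLog_sub_le (isPmf_outputPmf hW hp) (isPmf_outputPmf hW hq) hs
      (by linarith) hcard ((sum_abs_outputPmf_sub_le hW p q).trans hd)).trans ?_
    have h5 : 4 * s * Real.exp 1 ≤ n ^ 5 := by
      have : (2 : ℝ) ^ 4 ≤ n ^ 4 := by gcongr
      nlinarith
    have hlog : Real.log (2 * (2 * n) / s) + 1 ≤ 2 * Real.log (n ^ 3 / s) := by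
      calc Real.log (2 * (2 * n) / s) + 1
          = Real.log (2 * (2 * n) / s * Real.exp 1) := by
            rw [Real.log_mul (by positivity) (by positivity), Real.log_exp]
        _ ≤ Real.log ((n ^ 3 / s) ^ 2) := by
            refine Real.log_le_log (by positivity) ?_
            rw [div_pow, div_mul_eq_mul_div, div_le_div_iff₀ hs (by positivity)]
            have := mul_le_mul_of_nonneg_left h5 (by positivity : 0 ≤ n * s)
            nlinarith
        _ = 2 * Real.log (n ^ 3 / s) := by
            rw [Real.log_pow]
            norm_num
    have := mul_le_mul_of_nonneg_left hlog (by positivity : 0 ≤ s / 2)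
    linarith

theorem condMutualInfo_channel_le_condProd {W : A × B → Y → ℝ} (hW : ∀ x, IsPmf (W x))
    {p : U × A × B → ℝ} (hp : IsPmf p) (hU : Fintype.card U ≤ 2) {δ : ℝ} (hδ : 0 < δ)
    (hsmall : Real.sqrt (2 * δ * Real.log 2) < Fintype.card Y / Real.exp 1)
    (h : condMutualInfo p (fun z => z.2.1) (fun z => z.2.2) (fun z => z.1) ≤ δ) :
    condMutualInfo
      (fun z : U × A × B × Y => p (z.1, z.2.1, z.2.2.1) * W (z.2.1, z.2.2.1) z.2.2.2)
      (fun z => (z.2.1, z.2.2.1)) (fun z => z.2.2.2) (fun z => z.1)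
    ≤ condMutualInfo
      (fun z : U × A × B × Y => condProd p (z.1, z.2.1, z.2.2.1) * W (z.2.1, z.2.2.1) z.2.2.2)
      (fun z => (z.2.1, z.2.2.1)) (fun z => z.2.2.2) (fun z => z.1)
      + Real.sqrt (2 * δ * Real.log 2) *
          Real.logb 2 ((Fintype.card Y : ℝ) ^ 3 / Real.sqrt (2 * δ * Real.log 2))
      + Real.sqrt (2 * δ * Real.log 2) * Real.logb 2 (Fintype.card Y) := by
  have hlog2 := Real.log_pos one_lt_two
  have hd := sum_abs_sub_condProd_le hp h
  have hq := isPmf_condProd hp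
  have hs : 0 < Real.sqrt (2 * δ * Real.log 2) := Real.sqrt_pos.mpr (by positivity)
  set s := Real.sqrt (2 * δ * Real.log 2)
  have hY : 0 < Fintype.card Y := by
    rw [lt_div_iff₀ (Real.exp_pos 1)] at hsmall
    exact_mod_cast (mul_pos hs (Real.exp_pos 1)).trans hsmall
  have h1 := sum_negMulLog_outputPmf_sub_le hW hp hq hU (fun u => (sum_condProd hp.1 u).symm)
    hs hsmall hd
  rw [Finset.sum_sub_distrib] at h1
  have h2 : ∑ z, condProd p z * ∑ y, Real.negMulLog (W z.2 y)
      - ∑ z, p z * ∑ y, Real.negMulLog (W z.2 y) ≤ s * Real.log (Fintype.card Y) := by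
    rw [← Finset.sum_sub_distrib]
    calc ∑ z, (condProd p z * ∑ y, Real.negMulLog (W z.2 y)
          - p z * ∑ y, Real.negMulLog (W z.2 y))
        ≤ ∑ z, |p z - condProd p z| * Real.log (Fintype.card Y) :=
          Finset.sum_le_sum fun z _ => by
            rw [← sub_mul, abs_sub_comm]
            exact mul_le_mul (le_abs_self _) (sum_negMulLog_le_log_card (hW _) hY)
              (sum_negMulLog_nonneg (hW _)) (abs_nonneg _)
      _ ≤ s * Real.log (Fintype.card Y) := by
          rw [← Finset.sum_mul]
          exact mul_le_mul_of_nonneg_right hd (Real.log_natCast_nonneg _)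
  rw [condMutualInfo_channel_eq hW hp, condMutualInfo_channel_eq hW hq]
  simp only [Real.logb, sum_condProd hp.1, ← mul_div_assoc, ← add_div]
  refine div_le_div_of_nonneg_right ?_ hlog2.le
  linarith

end

/-- Quantitative continuity of `σ₁` at `δ = 0`: for all `δ > 0` with
`√(2δ ln 2) < |𝒴|/e`,
`σ₁(δ) ≤ σ₁(0) + √(2δ ln 2)·log₂(|𝒴|³/√(2δ ln 2)) + √(2δ ln 2)·log₂|𝒴|`. -/
theorem sigmaOne_continuity_at_zero (W : 𝒳₁ × 𝒳₂ → 𝒴 → ℝ) (hW : ∀ x, IsPmf (W x))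
    (δ : ℝ) (hδ : 0 < δ)
    (hsmall : Real.sqrt (2 * δ * Real.log 2) < Fintype.card 𝒴 / Real.exp 1) :
    sigmaOne W δ ≤ sigmaOne W 0
      + Real.sqrt (2 * δ * Real.log 2) *
          Real.logb 2 ((Fintype.card 𝒴 : ℝ) ^ 3 / Real.sqrt (2 * δ * Real.log 2))
      + Real.sqrt (2 * δ * Real.log 2) * Real.logb 2 (Fintype.card 𝒴) := by
  set S : ℝ → Set ℝ := fun δ => {r : ℝ | ∃ (k : ℕ) (_ : k ≤ 2) (p : Fin k × 𝒳₁ × 𝒳₂ → ℝ),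
    IsPmf p ∧
    condMutualInfo p (fun z => z.2.1) (fun z => z.2.2) (fun z => z.1) ≤ δ ∧
    r = condMutualInfo
      (fun z : Fin k × 𝒳₁ × 𝒳₂ × 𝒴 =>
        p (z.1, z.2.1, z.2.2.1) * W (z.2.1, z.2.2.1) z.2.2.2)
      (fun z => (z.2.1, z.2.2.1)) (fun z => z.2.2.2) (fun z => z.1)}
  have hbdd : BddAbove (S 0) := by
    refine ⟨2 * Fintype.card 𝒴 / Real.log 2, ?_⟩
    rintro r ⟨k, hk, p, hp, -, rfl⟩
    refine (condMutualInfo_channel_le hW hp).trans ?_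
    rw [Fintype.card_fin]
    have : (0 : ℝ) ≤ Real.log 2 := (Real.log_pos one_lt_two).le
    gcongr
    exact_mod_cast hk
  rcases (S δ).eq_empty_or_nonempty with hne | hne
  · have hne0 : S 0 = ∅ := by
      rw [← Set.subset_empty_iff, ← hne]
      rintro r ⟨k, hk, p, hp, h, hr⟩
      exact ⟨k, hk, p, hp, h.trans hδ.le, hr⟩
    have hs : 0 < Real.sqrt (2 * δ * Real.log 2) :=
      Real.sqrt_pos.mpr (by have := Real.log_pos one_lt_two; positivity)
    have hexp : (1 : ℝ) ≤ Real.exp 1 := Real.one_le_exp zero_le_one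
    have hsn : Real.sqrt (2 * δ * Real.log 2) < Fintype.card 𝒴 :=
      hsmall.trans_le (div_le_self (Nat.cast_nonneg _) hexp)
    have hn : (1 : ℝ) ≤ Fintype.card 𝒴 := by
      exact_mod_cast Nat.one_le_iff_ne_zero.mpr fun h0 => by
        rw [h0, Nat.cast_zero] at hsn
        exact hs.not_gt hsn
    have h1 : 1 ≤ (Fintype.card 𝒴 : ℝ) ^ 3 / Real.sqrt (2 * δ * Real.log 2) :=
      (one_le_div hs).mpr (hsn.le.trans (le_self_pow₀ hn (by norm_num)))
    have h2 := mul_nonneg hs.le (Real.logb_nonneg one_lt_two h1)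
    have h3 := mul_nonneg hs.le (Real.logb_nonneg one_lt_two hn)
    change sSup (S δ) ≤ sSup (S 0) + _ + _
    rw [hne, hne0]
    linarith
  · refine csSup_le hne ?_
    rintro r ⟨k, hk, p, hp, h, rfl⟩
    refine (condMutualInfo_channel_le_condProd hW hp (by simpa using hk) hδ hsmall h).trans ?_
    gcongr
    exact le_csSup hbdd ⟨k, hk, condProd p, isPmf_condProd hp,
      (condMutualInfo_condProd hp.1).le, rfl⟩
end
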